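/- For every integer d ≥ 1, the interior of the simplex T_d contains exactly one point of ℤ^d, namely the point (1,1,…,1); that is, ℤ^d ∩ int(T_d) = {(1,…,1)}. -/

import Mathlib

open MeasureTheory ENNReal

noncomputable section

/-- Auxiliary recursion for the Sylvester sequence: `s_{i+1} = s_i (s_i - 1) + 1`,
which is equivalent to `s_i = 1 + s_1 ⋯ s_{i-1}` with `s_1 = 2`. -/
def sylAux : ℕ → ℕ
  | 0 => 2
  | n + 1 => sylAux n * (sylAux n - 1) + 1

/-- The Sylvester sequence `s_1 = 2`, `s_i = 1 + s_1 s_2 ⋯ s_{i-1}` (1-indexed). -/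
def syl (n : ℕ) : ℕ := sylAux (n - 1)

/-- The standard basis vector `e_i` of `ℝ^d`. -/
def stdBasis (d : ℕ) (i : Fin d) : Fin d → ℝ := Pi.single i 1

/-- The integer lattice `ℤ^d`, viewed as a subset of `ℝ^d`. -/
def latticePts (d : ℕ) : Set (Fin d → ℝ) :=
  Set.range fun z : Fin d → ℤ => fun i => (z i : ℝ)

/-- The simplex `T_d = conv(0, s_1 e_1, …, s_d e_d)`. -/
def Td (d : ℕ) : Set (Fin d → ℝ) :=
  convexHull ℝ (insert 0 (Set.range fun i : Fin d => (syl (i.1 + 1) : ℝ) • stdBasis d i))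

lemma sylAux_ge (n : ℕ) : 2 ≤ sylAux n := by
  induction n with
  | zero => simp [sylAux]
  | succ n ih =>
    have h1 : 1 ≤ sylAux n - 1 := by omega
    have := Nat.mul_le_mul ih h1
    simp only [sylAux]
    omega

lemma sylAux_cast (n : ℕ) :
    (sylAux (n + 1) : ℝ) = (sylAux n : ℝ) * ((sylAux n : ℝ) - 1) + 1 := by
  have := sylAux_ge n
  simp only [sylAux]
  push_cast [Nat.cast_sub (show 1 ≤ sylAux n by omega)]
  ring

lemma sylAux_ge_real (n : ℕ) : (2 : ℝ) ≤ sylAux n := by exact_mod_cast sylAux_ge n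

lemma sylAux_sum (n : ℕ) :
    ∑ i ∈ Finset.range n, (1 / (sylAux i : ℝ)) = 1 - 1 / ((sylAux n : ℝ) - 1) := by
  induction n with
  | zero => norm_num [sylAux]
  | succ n ih =>
    rw [Finset.sum_range_succ, ih, sylAux_cast]
    have := sylAux_ge_real n
    have h1 : (sylAux n : ℝ) - 1 ≠ 0 := by linarith
    have h0 : (sylAux n : ℝ) ≠ 0 := by linarith
    have h2 : (sylAux n : ℝ) * ((sylAux n : ℝ) - 1) + 1 - 1 ≠ 0 := by
      rw [add_sub_cancel_right]; exact mul_ne_zero h0 h1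
    rw [add_sub_cancel_right]
    field_simp
    ring

lemma sylAux_lt (n j : ℕ) (h : j < n) : (sylAux j : ℝ) ≤ (sylAux n : ℝ) - 1 := by
  have step : ∀ m, (sylAux m : ℝ) ≤ (sylAux (m + 1) : ℝ) - 1 := by
    intro m
    rw [sylAux_cast]
    have := sylAux_ge_real m
    nlinarith
  induction n with
  | zero => omega
  | succ n ih =>
    rcases Nat.lt_succ_iff_lt_or_eq.mp h with h | h
    · have := ih h
      have := step n
      linarith
    · subst h; exact step j

lemma Td_sub (d : ℕ) (x : Fin d → ℝ) (hx : x ∈ Td d) :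
    (∀ i, 0 ≤ x i) ∧ ∑ i, x i / (sylAux i : ℝ) ≤ 1 := by
  have hc : Convex ℝ {x : Fin d → ℝ | (∀ i, 0 ≤ x i) ∧ ∑ i, x i / (sylAux i : ℝ) ≤ 1} := by
    intro x hx y hy a b ha hb hab
    refine ⟨fun i => ?_, ?_⟩
    · have := hx.1 i
      have := hy.1 i
      simp only [Pi.add_apply, Pi.smul_apply, smul_eq_mul]
      positivity
    · have : ∑ i, (a • x + b • y) i / (sylAux i : ℝ)
          = a * ∑ i, x i / (sylAux i : ℝ) + b * ∑ i, y i / (sylAux i : ℝ) := by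
        rw [Finset.mul_sum, Finset.mul_sum, ← Finset.sum_add_distrib]
        refine Finset.sum_congr rfl fun i _ => ?_
        simp only [Pi.add_apply, Pi.smul_apply, smul_eq_mul]
        ring
      rw [this]
      nlinarith [hx.2, hy.2]
  refine convexHull_min ?_ hc hx
  rintro y (rfl | ⟨j, rfl⟩)
  · simp
  · refine ⟨fun i => ?_, ?_⟩
    · simp only [stdBasis, Pi.smul_apply, smul_eq_mul, Pi.single_apply]
      split_ifs <;> simp
    · have := sylAux_ge_real j
      have h0 : (sylAux j : ℝ) ≠ 0 := by linarith
      simp only [stdBasis, Pi.smul_apply, smul_eq_mul, Pi.single_apply, syl,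
        Nat.add_sub_cancel]
      rw [Finset.sum_eq_single j]
      · simp [h0]
      · intro b _ hb; simp [hb]
      · simp

lemma sub_Td (d : ℕ) (x : Fin d → ℝ) (h0 : ∀ i, 0 ≤ x i)
    (h1 : ∑ i, x i / (sylAux i : ℝ) ≤ 1) : x ∈ Td d := by
  have hc : Convex ℝ (Td d) := convex_convexHull _ _
  have hz : (0 : Fin d → ℝ) ∈ Td d := subset_convexHull _ _ (Set.mem_insert _ _)
  have hp : ∀ i : Fin d, (syl (i.1 + 1) : ℝ) • stdBasis d i ∈ Td d := fun i =>
    subset_convexHull _ _ (Set.mem_insert_of_mem _ ⟨i, rfl⟩)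
  have key := hc.sum_mem (t := (Finset.univ : Finset (Option (Fin d))))
    (w := fun o => o.elim (1 - ∑ i, x i / (sylAux i : ℝ)) (fun i => x i / (sylAux i : ℝ)))
    (z := fun o => o.elim 0 (fun i => (syl (i.1 + 1) : ℝ) • stdBasis d i))
    (by
      rintro (_ | i) _
      · simpa using h1
      · exact div_nonneg (h0 i) (Nat.cast_nonneg _))
    (by simp [Fintype.sum_option])
    (by
      rintro (_ | i) _
      · exact hz
      · exact hp i)
  convert key using 1
  rw [Fintype.sum_option]
  ext j
  have := sylAux_ge_real j
  have hj : (sylAux j : ℝ) ≠ 0 := by linarith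
  simp only [Option.elim, smul_zero, zero_add, Finset.sum_apply, Pi.smul_apply, smul_eq_mul,
    stdBasis, Pi.single_apply, syl, Nat.add_sub_cancel]
  rw [Finset.sum_eq_single j]
  · simp [hj]
  · intro b _ hb; simp [hb.symm]
  · simp

lemma int_dir {d : ℕ} {S : Set (Fin d → ℝ)} {x : Fin d → ℝ} (hx : x ∈ interior S)
    (v : Fin d → ℝ) : ∃ t : ℝ, 0 < t ∧ x + t • v ∈ S := by
  have hcont : Continuous (fun t : ℝ => x + t • v) := by fun_prop
  have hopen := isOpen_interior (s := S).preimage hcont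
  have h0 : (0 : ℝ) ∈ (fun t : ℝ => x + t • v) ⁻¹' interior S := by simpa using hx
  obtain ⟨e, he, hb⟩ := Metric.isOpen_iff.mp hopen 0 h0
  refine ⟨e / 2, by positivity, interior_subset (hb ?_)⟩
  rw [Metric.mem_ball, Real.dist_eq, sub_zero, abs_of_pos (by positivity)]
  linarith

/-- For every `d ≥ 1`, the interior of the simplex `T_d` contains exactly one lattice
point, namely `(1,…,1)`: that is, `ℤ^d ∩ int T_d = {(1,…,1)}`. -/
theorem interior_lattice_points_of_Td (d : ℕ) (hd : 1 ≤ d) :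
    latticePts d ∩ interior (Td d) = {fun _ => (1 : ℝ)} := by
  have hsum : ∑ i : Fin d, (1 / (sylAux i : ℝ)) = 1 - 1 / ((sylAux d : ℝ) - 1) := by
    rw [Fin.sum_univ_eq_sum_range (fun i => 1 / (sylAux i : ℝ)), sylAux_sum]
  have hd2 := sylAux_ge_real d
  apply Set.Subset.antisymm
  · rintro x ⟨⟨z, rfl⟩, hx⟩
    have hx0 := Td_sub d _ (interior_subset hx)
    have hpos : ∀ i, (1 : ℤ) ≤ z i := by
      intro i
      obtain ⟨t, ht, hm⟩ := int_dir hx (-Pi.single i 1)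
      have := (Td_sub d _ hm).1 i
      simp at this
      have h : (0 : ℝ) < z i := by linarith
      exact_mod_cast h
    have hlt : ∑ i, (z i : ℝ) / (sylAux i : ℝ) < 1 := by
      obtain ⟨t, ht, hm⟩ := int_dir hx (fun i => (z i : ℝ))
      have h := (Td_sub d _ hm).2
      have e : ∑ i, ((fun i => (z i : ℝ)) + t • (fun i => (z i : ℝ))) i / (sylAux i : ℝ)
          = (1 + t) * ∑ i, (z i : ℝ) / (sylAux i : ℝ) := by
        rw [Finset.mul_sum]
        refine Finset.sum_congr rfl fun i _ => ?_
        simp only [Pi.add_apply, Pi.smul_apply, smul_eq_mul]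
        ring
      rw [e] at h
      by_contra hcon
      nlinarith
    rw [Set.mem_singleton_iff]
    ext j
    by_contra hne
    have hj : (2 : ℤ) ≤ z j := by
      have h1 := hpos j
      have : z j ≠ 1 := fun h => hne (by simp [h])
      omega
    have hdiff : 1 / (sylAux j : ℝ) ≤ ∑ i, ((z i : ℝ) - 1) / (sylAux i : ℝ) := by
      refine le_trans ?_ (Finset.single_le_sum (f := fun i : Fin d =>
        ((z i : ℝ) - 1) / (sylAux i : ℝ)) (fun i _ => ?_) (Finset.mem_univ j))
      · have : (2 : ℝ) ≤ z j := by exact_mod_cast hj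
        have h : (1 : ℝ) ≤ z j - 1 := by linarith
        exact div_le_div_of_nonneg_right h (Nat.cast_nonneg _)
      · have : (1 : ℝ) ≤ z i := by exact_mod_cast hpos i
        exact div_nonneg (by linarith) (Nat.cast_nonneg _)
    simp only [sub_div, Finset.sum_sub_distrib] at hdiff
    rw [hsum] at hdiff
    have h2 := sylAux_ge_real j
    have := one_div_le_one_div_of_le (by linarith) (sylAux_lt d j j.2)
    linarith
  · rintro x rfl
    refine ⟨⟨fun _ => 1, by simp⟩, ?_⟩
    rw [mem_interior]
    refine ⟨{x | (∀ i, 0 < x i) ∧ ∑ i, x i / (sylAux i : ℝ) < 1}, ?_, ?_, ?_⟩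
    · rintro x ⟨h0, h1⟩
      exact sub_Td d x (fun i => (h0 i).le) h1.le
    · refine IsOpen.and ?_ ?_
      · simp only [Set.setOf_forall]
        exact isOpen_iInter_of_finite fun i => isOpen_lt continuous_const (continuous_apply i)
      · exact isOpen_lt (by fun_prop) continuous_const
    · refine ⟨fun _ => one_pos, ?_⟩
      rw [hsum]
      have : 0 < 1 / ((sylAux d : ℝ) - 1) := one_div_pos.mpr (by linarith)
      linarith
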